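/- Let A be the weighted adjacency matrix of a connected undirected weighted graph without loops whose row sums are all positive, D the diagonal matrix of row sums, and 𝓛 = I − D^{-1/2} A D^{-1/2} the normalized Laplacian. Let S₁, …, S_p be pairwise disjoint subsets of vertices, with |S_t| = m_t ≥ 2, such that each S_t carries an (m_t,k_t,s_t)-star with central weight a_t and weight w_t, and suppose the ratio a_t / w_t = ρ is the same for all t. Then 1 + ρ is an eigenvalue of 𝓛 and the eigenspace ker(𝓛 − (1 + ρ)·I) has dimension at least Σ_{t=1}^{p} (m_t − 1). -/

import Mathlib

/-- If `i` and `j` lie in a star with central weight `a` and weight `w`, then `e_i - e_j` is an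
eigenvector of the normalized Laplacian for `1 + a / w`. -/
theorem normalizedLaplacian_mulVec_single_sub_single {V : Type*} [Fintype V] [DecidableEq V]
    {A : Matrix V V ℝ} (hsymm : A.IsSymm) (hdiag : ∀ i, A i i = 0) {S : Finset V} {a w : ℝ}
    (hw0 : 0 ≤ w) (hcenter : ∀ i ∈ S, ∀ j ∈ S, i ≠ j → A i j = a)
    (hout : ∀ i ∈ S, ∀ j ∈ S, ∀ l, l ∉ S → A i l = A j l)
    (hw : ∀ i ∈ S, ∑ l, A i l = w) {i j : V} (hi : i ∈ S) (hj : j ∈ S) (hij : i ≠ j) :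
    (1 - Matrix.diagonal (fun i => (Real.sqrt (∑ j, A i j))⁻¹) * A *
        Matrix.diagonal (fun i => (Real.sqrt (∑ j, A i j))⁻¹)).mulVec
        (Pi.single i 1 - Pi.single j 1) =
      (1 + a / w) • (Pi.single i 1 - Pi.single j 1 : V → ℝ) := by
  have hsq : (Real.sqrt w)⁻¹ * (Real.sqrt w)⁻¹ = w⁻¹ := by
    rw [← mul_inv, Real.mul_self_sqrt hw0]
  ext l
  simp only [Matrix.mulVec_sub, Matrix.mulVec_single_one, Pi.sub_apply, Matrix.col_apply,
    Matrix.sub_apply, Matrix.mul_diagonal, Matrix.diagonal_mul, Matrix.one_apply, Pi.smul_apply,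
    smul_eq_mul, Pi.single_apply, hw i hi, hw j hj]
  by_cases hl : l ∈ S
  · rw [hw l hl]
    by_cases hli : l = i
    · subst hli
      simp only [hdiag, hcenter l hi j hj hij, hij, if_true, if_false]
      linear_combination a * hsq
    · by_cases hlj : l = j
      · subst hlj
        simp only [hdiag, hcenter l hj i hi hij.symm, hij.symm, if_true, if_false]
        linear_combination -a * hsq
      · simp only [hcenter l hl i hi hli, hcenter l hl j hj hlj, hli, hlj, if_false]
        ring
  · have hli : l ≠ i := fun h => hl (h ▸ hi)
    have hlj : l ≠ j := fun h => hl (h ▸ hj)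
    have hA : A l i = A l j := by
      rw [← hsymm.apply, ← hsymm.apply l j, hout i hi j hj l hl]
    simp only [hli, hlj, if_false, hA]
    ring

/-- Given pairwise disjoint sets with base points, the differences `e_i - e_b` of a non-base
point `i` and the base point `b` of its set are linearly independent. -/
theorem linearIndependent_single_sub_single {V ι : Type*} [DecidableEq V] [Finite ι]
    {S : ι → Finset V} (hdisj : ∀ t t', t ≠ t' → Disjoint (S t) (S t'))
    {b : ι → V} (hb : ∀ t, b t ∈ S t) :
    LinearIndependent ℝ (fun x : Σ t, ((S t).erase (b t) : Finset V) =>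
      (Pi.single (x.2 : V) 1 - Pi.single (b x.1) 1 : V → ℝ)) := by
  classical
  have mem (x : Σ t, ((S t).erase (b t) : Finset V)) : (x.2 : V) ∈ S x.1 :=
    Finset.mem_of_mem_erase x.2.2
  have index_eq {t t' : ι} {v : V} (h : v ∈ S t) (h' : v ∈ S t') : t = t' := by
    by_contra hne
    exact Finset.disjoint_left.1 (hdisj t t' hne) h h'
  refine LinearIndependent.of_comp
    (LinearMap.funLeft ℝ ℝ (fun x : Σ t, ((S t).erase (b t) : Finset V) => (x.2 : V))) ?_
  convert Pi.linearIndependent_single_one (Σ t, ((S t).erase (b t) : Finset V)) ℝ using 1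
  ext y x
  have hbase : (x.2 : V) ≠ b y.1 := by
    intro h
    have ht : x.1 = y.1 := index_eq (mem x) (h ▸ hb y.1)
    exact Finset.ne_of_mem_erase x.2.2 (h.trans (congrArg b ht.symm))
  have hiff : (x.2 : V) = y.2 ↔ x = y := by
    refine ⟨fun h => ?_, fun h => h ▸ rfl⟩
    have ht : x.1 = y.1 := index_eq (mem x) (h ▸ mem y)
    obtain ⟨t, x⟩ := x
    obtain ⟨t', y⟩ := y
    obtain rfl : t = t' := ht
    exact congrArg (Sigma.mk t) (Subtype.ext h)
  simp [LinearMap.funLeft_apply, Pi.single_apply, hbase, hiff]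


/-- In a connected loopless weighted graph with all row sums positive, if
pairwise disjoint subsets `S t` (of sizes `m t ≥ 2`) carry `(m_t,k_t,s_t)`-stars with central
weights `a t` and weights `w t` such that the ratio `a t / w t = ρ` is the same for all `t`,
then `1 + ρ` is an eigenvalue of the normalized Laplacian
`𝓛 = I - D^{-1/2} A D^{-1/2}` with eigenspace of dimension at least `∑ (m t - 1)`. -/
theorem stmt_5 {n p : ℕ} (hp : 0 < p) (A : Matrix (Fin n) (Fin n) ℝ)
    (hsymm : A.IsSymm)
    (hnonneg : ∀ i j, 0 ≤ A i j)
    (hdiag : ∀ i, A i i = 0)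
    (hconn : (SimpleGraph.fromRel (fun i j : Fin n => A i j ≠ 0)).Connected)
    (hpos : ∀ i, 0 < ∑ j, A i j)
    (Dinvhalf NL : Matrix (Fin n) (Fin n) ℝ)
    (hDinvhalf : Dinvhalf = Matrix.diagonal (fun i => (Real.sqrt (∑ j, A i j))⁻¹))
    (hNL : NL = 1 - Dinvhalf * A * Dinvhalf)
    (S : Fin p → Finset (Fin n)) (m : Fin p → ℕ)
    (hm : ∀ t, 2 ≤ m t) (hcard : ∀ t, (S t).card = m t)
    (hdisj : ∀ t t', t ≠ t' → Disjoint (S t) (S t'))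
    (a w : Fin p → ℝ) (ha : ∀ t, 0 ≤ a t)
    (hstar_center : ∀ t, ∀ i ∈ S t, ∀ j ∈ S t, i ≠ j → A i j = a t)
    (hstar_out : ∀ t, ∀ i ∈ S t, ∀ j ∈ S t, ∀ l, l ∉ S t → A i l = A j l)
    (hw : ∀ t, ∀ i ∈ S t, ∑ l, A i l = w t)
    (ρ : ℝ) (hρ : ∀ t, a t / w t = ρ) :
    Module.End.HasEigenvalue (Matrix.toLin' NL) (1 + ρ) ∧
    (∑ t, (m t - 1)) ≤
      Module.finrank ℝ (Module.End.eigenspace (Matrix.toLin' NL) (1 + ρ)) := by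
  subst hDinvhalf hNL
  have hne (t) : (S t).Nonempty :=
    Finset.card_pos.1 (by have := hm t; have := hcard t; omega)
  choose b hb using hne
  have hmem (x : Σ t, ((S t).erase (b t) : Finset (Fin n))) :
      (Pi.single (x.2 : Fin n) 1 - Pi.single (b x.1) 1 : Fin n → ℝ) ∈
        Module.End.eigenspace (Matrix.toLin' (1 -
          Matrix.diagonal (fun i => (Real.sqrt (∑ j, A i j))⁻¹) * A *
          Matrix.diagonal (fun i => (Real.sqrt (∑ j, A i j))⁻¹))) (1 + ρ) := by
    rw [Module.End.mem_eigenspace_iff, Matrix.toLin'_apply, ← hρ x.1]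
    exact normalizedLaplacian_mulVec_single_sub_single hsymm hdiag
      (hw x.1 _ (hb x.1) ▸ (hpos _).le) (hstar_center x.1) (hstar_out x.1) (hw x.1)
      (Finset.mem_of_mem_erase x.2.2) (hb x.1) (Finset.ne_of_mem_erase x.2.2)
  have hli := LinearIndependent.of_comp (Submodule.subtype _)
    (v := fun x => (⟨_, hmem x⟩ : Module.End.eigenspace _ (1 + ρ)))
    (linearIndependent_single_sub_single hdisj hb)
  have hdim := hli.fintype_card_le_finrank
  simp only [Fintype.card_sigma, Fintype.card_coe, Finset.card_erase_of_mem (hb _), hcard] at hdim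
  refine ⟨fun hbot => ?_, hdim⟩
  have hsum : m ⟨0, hp⟩ - 1 ≤ ∑ t, (m t - 1) :=
    Finset.single_le_sum (f := fun t => m t - 1) (fun _ _ => Nat.zero_le _) (Finset.mem_univ _)
  have h2 := hm ⟨0, hp⟩
  have hzero := (Submodule.finrank_eq_zero (R := ℝ)).2 hbot
  change Module.finrank ℝ (Module.End.eigenspace _ _) = 0 at hzero
  omega
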